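/- Let n ≥ 10, let (x,y) ∈ ℤ² with |y| ≥ 2 satisfy (x − F_n·y)(x − L_n·y)·x − y³ = ±1, let j ∈ {1,2,3} be an index at which |x − r_i·y| is minimal, and let {k,l} = {1,2,3} \ {j}. Writing β_i := x − r_i·y, one has |(β_j/β_k)·((r_l − r_k)/(r_j − r_l))| ≤ 8·α^8·|y|^{−3}·α^{−3n}. -/

import Mathlib

open Real

/-- The golden ratio α = (1+√5)/2. -/
noncomputable def alpha : ℝ := (1 + Real.sqrt 5) / 2

/-- The Lucas sequence: L 0 = 2, L 1 = 1, L (n+2) = L (n+1) + L n. -/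
def lucas : ℕ → ℤ
  | 0 => 2
  | 1 => 1
  | n + 2 => lucas (n + 1) + lucas n

/-- The cubic polynomial f_n(X) = (X − F_n)(X − L_n)X − 1. -/
noncomputable def fpoly (n : ℕ) (X : ℝ) : ℝ :=
  (X - (Nat.fib n : ℝ)) * (X - (lucas n : ℝ)) * X - 1

lemma alpha_sq : alpha ^ 2 = alpha + 1 := by
  have h : Real.sqrt 5 ^ 2 = 5 := Real.sq_sqrt (by norm_num)
  unfold alpha
  linear_combination h / 4

lemma one_lt_alpha : 1 < alpha := by
  have h : 1 < Real.sqrt 5 := Real.lt_sqrt_of_sq_lt (by norm_num)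
  unfold alpha
  linarith

lemma alpha_lt : alpha < 1.62 := by
  have h : Real.sqrt 5 < 2.24 := by
    rw [Real.sqrt_lt' (by norm_num)]
    norm_num
  unfold alpha
  linarith

lemma lucas_succ_eq (m : ℕ) : lucas (m + 1) = Nat.fib m + Nat.fib (m + 2) := by
  induction m using Nat.twoStepInduction with
  | zero => simp [lucas]
  | one => simp [lucas, Nat.fib_add_two]
  | more m ih₁ ih₂ =>
    have h : lucas (m + 2 + 1) = lucas (m + 1 + 1) + lucas (m + 1) := rfl
    rw [h, ih₁, ih₂]
    simp only [Nat.fib_add_two, Nat.cast_add]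
    ring

lemma two_mul_fib_le_lucas (m : ℕ) : 2 * (Nat.fib (m + 2) : ℤ) ≤ lucas (m + 2) := by
  have h : Nat.fib m ≤ Nat.fib (m + 1) := Nat.fib_le_fib_succ
  rw [lucas_succ_eq]
  simp only [Nat.fib_add_two, Nat.cast_add]
  omega

lemma alpha_pow_le_fib (m : ℕ) :
    alpha ^ (m + 8) + 2 ≤ (Nat.fib (m + 10) : ℝ) := by
  have h4 : alpha ^ 4 = 3 * alpha + 2 := by
    linear_combination (alpha ^ 2 + alpha + 2) * alpha_sq
  have h8 : alpha ^ 8 = 21 * alpha + 13 := by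
    linear_combination (alpha ^ 4 + 3 * alpha + 2) * h4 + 9 * alpha_sq
  induction m using Nat.twoStepInduction with
  | zero =>
    have h : Nat.fib 10 = 55 := by decide
    have := alpha_lt
    norm_num [h]
    linarith
  | one =>
    have h : Nat.fib 11 = 89 := by decide
    have h9 : alpha ^ 9 = 34 * alpha + 21 := by
      linear_combination alpha * h8 + 21 * alpha_sq
    have := alpha_lt
    norm_num [h]
    linarith
  | more m ih₁ ih₂ =>
    have h : Nat.fib (m + 2 + 10) = Nat.fib (m + 10) + Nat.fib (m + 1 + 10) :=
      Nat.fib_add_two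
    have hp : alpha ^ (m + 2 + 8) = alpha ^ (m + 1 + 8) + alpha ^ (m + 8) := by
      linear_combination alpha ^ (m + 8) * alpha_sq
    rw [h, hp]
    push_cast
    linarith

/-- Vieta's formulas for the cubic `(X - F) (X - L) X - 1` with three distinct roots. -/
lemma vieta_of_distinct_roots {F L a b c : ℝ} (ha : (a - F) * (a - L) * a - 1 = 0)
    (hb : (b - F) * (b - L) * b - 1 = 0) (hc : (c - F) * (c - L) * c - 1 = 0)
    (hab : a ≠ b) (hac : a ≠ c) (hbc : b ≠ c) :
    a + b + c = F + L ∧ a * b + a * c + b * c = F * L ∧ a * b * c = 1 := by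
  have h₁ : a ^ 2 + a * b + b ^ 2 - (F + L) * (a + b) + F * L = 0 :=
    mul_left_cancel₀ (sub_ne_zero.2 hab) (by linear_combination ha - hb)
  have h₂ : a ^ 2 + a * c + c ^ 2 - (F + L) * (a + c) + F * L = 0 :=
    mul_left_cancel₀ (sub_ne_zero.2 hac) (by linear_combination ha - hc)
  have h₃ : a + b + c = F + L :=
    mul_left_cancel₀ (sub_ne_zero.2 hbc) (by linear_combination h₁ - h₂)
  have h₄ : a * b + a * c + b * c = F * L := by
    linear_combination (a + b) * h₃ - h₁
  exact ⟨h₃, h₄, by linear_combination ha - a ^ 2 * h₃ + a * h₄⟩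

lemma root_location {F L t : ℝ} (hF : 0 < F) (hFL : F < L)
    (ht : (t - F) * (t - L) * t - 1 = 0) : 0 < t ∧ (t < F ∨ L < t) := by
  have hpos : 0 < t := by
    by_contra! h
    have : 0 ≤ (t - F) * (t - L) := mul_nonneg_of_nonpos_of_nonpos (by linarith) (by linarith)
    nlinarith
  refine ⟨hpos, ?_⟩
  by_contra! h
  have : (t - F) * (t - L) ≤ 0 :=
    mul_nonpos_of_nonneg_of_nonpos (by linarith) (by linarith)
  nlinarith

lemma root_location_of_lt {F L t : ℝ} (hFL : F < L) (htF : t < F)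
    (ht : (t - F) * (t - L) * t - 1 = 0) : t ≤ 1 ∨ F - 1 ≤ t := by
  by_contra! h
  have h₁ : 1 < (F - t) * (L - t) := one_lt_mul_of_lt_of_le (by linarith) (by linarith)
  nlinarith

/-- Lower bounds for the gaps between the ordered roots `c < a < b`. -/
lemma root_gaps {F L a b c : ℝ} (hF : 5 ≤ F) (hL : 2 * F ≤ L)
    (ha : (a - F) * (a - L) * a - 1 = 0) (hb : (b - F) * (b - L) * b - 1 = 0)
    (hc : (c - F) * (c - L) * c - 1 = 0) (hca : c < a) (hab : a < b) :
    F - 2 ≤ a - c ∧ F ≤ b - a := by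
  obtain ⟨h₁, h₂, h₃⟩ := vieta_of_distinct_roots ha hb hc hab.ne hca.ne' (hca.trans hab).ne'
  have hF0 : 0 < F := by linarith
  have hFL : F < L := by linarith
  obtain ⟨hb0, hb'⟩ := root_location hF0 hFL hb
  obtain ⟨ha0, ha'⟩ := root_location hF0 hFL ha
  obtain ⟨hc0, -⟩ := root_location hF0 hFL hc
  have hbL : L < b := hb'.resolve_left fun h => by linarith
  have haF : a < F := ha'.resolve_right fun h => by linarith
  have hc1 : c ≤ 1 := by
    refine (root_location_of_lt hFL (hca.trans haF) hc).resolve_right fun h => ?_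
    have : 1 < a * b := one_lt_mul_of_lt_of_le (by linarith) (by linarith)
    nlinarith
  have haF' : F - 1 ≤ a := by
    refine (root_location_of_lt hFL haF ha).resolve_left fun h => ?_
    have hbu : b ≤ F + L := by linarith
    have : (a + c) * b ≤ 2 * (F + L) :=
      mul_le_mul (by linarith) hbu hb0.le (by norm_num)
    have : a * c ≤ 1 := mul_le_one₀ h hc0.le hc1
    nlinarith
  constructor <;> linarith

/-- If `β_j` is the smallest of three numbers `β_i = x - r_i y` of product `±1`, then the quotient
`β_j / β_k` is bounded in terms of the gaps between the `r_i`. -/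
lemma abs_quotient_le {x y a b c A G : ℝ} (hy : y ≠ 0) (hA : 0 < A) (hG : 2 ≤ G)
    (hprod : |(x - a * y) * (x - b * y) * (x - c * y)| = 1)
    (hb : |x - a * y| ≤ |x - b * y|) (hc : |x - a * y| ≤ |x - c * y|)
    (hab : A ≤ |a - b| * G) (hac : A ≤ |a - c| * G) :
    |((x - a * y) / (x - b * y)) * ((c - b) / (a - c))| ≤ 8 * G ^ 4 / (|y| ^ 3 * A ^ 3) := by
  have hy0 : 0 < |y| := abs_pos.2 hy
  have hp : 0 < |a - b| := pos_of_mul_pos_left (hA.trans_le hab) (by linarith)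
  have hq : 0 < |a - c| := pos_of_mul_pos_left (hA.trans_le hac) (by linarith)
  have hs : |c - b| ≤ |a - b| + |a - c| := by
    have := abs_sub_le c a b
    rw [abs_sub_comm c a] at this
    linarith
  have hB : |a - b| * |y| / 2 ≤ |x - b * y| := by
    have := abs_sub (x - b * y) (x - a * y)
    rw [show x - b * y - (x - a * y) = (a - b) * y by ring, abs_mul] at this
    linarith
  have hC : |a - c| * |y| / 2 ≤ |x - c * y| := by
    have := abs_sub (x - c * y) (x - a * y)
    rw [show x - c * y - (x - a * y) = (a - c) * y by ring, abs_mul] at this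
    linarith
  have hs0 : 0 ≤ |c - b| := abs_nonneg _
  rw [abs_mul, abs_mul] at hprod
  rw [abs_mul, abs_div, abs_div]
  generalize |x - a * y| = δ at *
  generalize |x - b * y| = β at *
  generalize |x - c * y| = γ at *
  generalize |a - b| = p at *
  generalize |a - c| = q at *
  generalize |c - b| = s at *
  generalize |y| = Y at *
  have hβ : 0 < β := lt_of_lt_of_le (by positivity) hB
  have hγ : 0 < γ := lt_of_lt_of_le (by positivity) hC
  have hβγ : p ^ 2 * q * Y ^ 3 / 8 ≤ β ^ 2 * γ := by
    calc p ^ 2 * q * Y ^ 3 / 8 = (p * Y / 2) ^ 2 * (q * Y / 2) := by ring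
      _ ≤ β ^ 2 * γ := by gcongr
  have hgap : (p + q) * A ^ 3 ≤ G ^ 4 * (p ^ 2 * q ^ 2) := by
    have h₁ : A ^ 3 ≤ (p * G) * (q * G) * (q * G) := by
      calc A ^ 3 = A * A * A := by ring
        _ ≤ _ := by gcongr
    have h₂ : A ^ 3 ≤ (p * G) * (p * G) * (q * G) := by
      calc A ^ 3 = A * A * A := by ring
        _ ≤ _ := by gcongr
    calc (p + q) * A ^ 3 = p * A ^ 3 + q * A ^ 3 := by ring
      _ ≤ p * ((p * G) * (q * G) * (q * G)) + q * ((p * G) * (p * G) * (q * G)) := by gcongr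
      _ = 2 * (G ^ 3 * (p ^ 2 * q ^ 2)) := by ring
      _ ≤ G * (G ^ 3 * (p ^ 2 * q ^ 2)) := by gcongr
      _ = G ^ 4 * (p ^ 2 * q ^ 2) := by ring
  have hδ : δ / β = 1 / (β ^ 2 * γ) := by
    field_simp
    linarith
  calc δ / β * (s / q) ≤ 1 / (p ^ 2 * q * Y ^ 3 / 8) * ((p + q) / q) := by
        rw [hδ]
        gcongr
    _ = 8 * (p + q) / (Y ^ 3 * (p ^ 2 * q ^ 2)) := by
        field_simp
    _ ≤ 8 * G ^ 4 / (Y ^ 3 * A ^ 3) := by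
        rw [div_le_div_iff₀ (by positivity) (by positivity)]
        calc 8 * (p + q) * (Y ^ 3 * A ^ 3) = 8 * Y ^ 3 * ((p + q) * A ^ 3) := by ring
          _ ≤ 8 * Y ^ 3 * (G ^ 4 * (p ^ 2 * q ^ 2)) := by gcongr
          _ = _ := by ring

theorem gamma_upper_bound (n : ℕ) (hn : 10 ≤ n) (x y : ℤ) (hy : 2 ≤ |y|)
    (heq : (x - (Nat.fib n : ℤ) * y) * (x - lucas n * y) * x - y ^ 3 = 1 ∨
      (x - (Nat.fib n : ℤ) * y) * (x - lucas n * y) * x - y ^ 3 = -1)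
    (r : Fin 3 → ℝ)
    (hroot : ∀ i, fpoly n (r i) = 0)
    (hord : r 2 < r 0 ∧ r 0 < r 1)
    (j k l : Fin 3) (hjk : j ≠ k) (hjl : j ≠ l) (hkl : k ≠ l)
    (hmin : ∀ i, |(x : ℝ) - r j * (y : ℝ)| ≤ |(x : ℝ) - r i * (y : ℝ)|) :
    |(((x : ℝ) - r j * (y : ℝ)) / ((x : ℝ) - r k * (y : ℝ))) *
        ((r l - r k) / (r j - r l))|
      ≤ 8 * alpha ^ 8 * |(y : ℝ)| ^ (-3 : ℤ) * alpha ^ (-(3 * n : ℤ)) := by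
  have hα := one_lt_alpha
  have hα0 : 0 < alpha := by linarith
  have hG : 2 ≤ alpha ^ 2 := by rw [alpha_sq]; linarith
  obtain ⟨m, rfl⟩ := Nat.exists_eq_add_of_le' hn
  have hF := alpha_pow_le_fib m
  have hF55 : (55 : ℝ) ≤ Nat.fib (m + 10) := by
    have h : Nat.fib 10 ≤ Nat.fib (m + 10) := Nat.fib_mono (by omega)
    exact_mod_cast h
  have hL : 2 * (Nat.fib (m + 10) : ℝ) ≤ lucas (m + 10) := by
    exact_mod_cast two_mul_fib_le_lucas (m + 8)
  unfold fpoly at hroot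
  obtain ⟨hg₁, hg₂⟩ := root_gaps (by linarith) hL (hroot 0) (hroot 1) (hroot 2) hord.1 hord.2
  obtain ⟨h₁, h₂, h₃⟩ := vieta_of_distinct_roots (hroot 0) (hroot 1) (hroot 2)
    hord.2.ne hord.1.ne' (hord.1.trans hord.2).ne'
  have hgap : ∀ i i' : Fin 3, i ≠ i' → alpha ^ (m + 8) ≤ |r i - r i'| := by
    intro i i' hi
    rw [le_abs']
    fin_cases i <;> fin_cases i' <;> first | exact absurd rfl hi | skip
    all_goals simp only [Fin.zero_eta, Fin.mk_one, Fin.reduceFinMk]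
    all_goals first | (left; linarith) | (right; linarith)
  have hgap' : ∀ i i' : Fin 3, i ≠ i' → alpha ^ (m + 10) ≤ |r i - r i'| * alpha ^ 2 := by
    intro i i' hi
    rw [show m + 10 = m + 8 + 2 by rfl, pow_add]
    gcongr
    exact hgap i i' hi
  have hprod₀ : |(x - r 0 * y) * (x - r 1 * y) * (x - r 2 * y)| = 1 := by
    have hexp : (x - r 0 * y) * (x - r 1 * y) * (x - r 2 * y) =
        ((x : ℝ) - Nat.fib (m + 10) * y) * (x - lucas (m + 10) * y) * x - y ^ 3 := by
      linear_combination (-(x : ℝ) ^ 2 * y) * h₁ + (x * (y : ℝ) ^ 2) * h₂ - (y : ℝ) ^ 3 * h₃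
    rw [hexp, abs_eq zero_le_one]
    exact_mod_cast heq
  have hprod : |(x - r j * y) * (x - r k * y) * (x - r l * y)| = 1 := by
    rw [← hprod₀]
    congr 1
    fin_cases j <;> fin_cases k <;> fin_cases l <;>
      first | exact absurd rfl hjk | exact absurd rfl hjl | exact absurd rfl hkl | skip
    all_goals simp only [Fin.zero_eta, Fin.mk_one, Fin.reduceFinMk]
    all_goals ring
  have hy0 : (y : ℝ) ≠ 0 := by
    rintro h
    rw [Int.cast_eq_zero] at h
    simp [h] at hy
  refine (abs_quotient_le hy0 (pow_pos hα0 (m + 10)) hG hprod (hmin k) (hmin l)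
    (hgap' j k hjk) (hgap' j l hjl)).trans_eq ?_
  have hz₁ : |(y : ℝ)| ^ (-3 : ℤ) = (|(y : ℝ)| ^ 3)⁻¹ := by
    rw [zpow_neg]
    norm_cast
  have hz₂ : alpha ^ (-(3 * (m + 10 : ℕ) : ℤ)) = ((alpha ^ (m + 10)) ^ 3)⁻¹ := by
    rw [zpow_neg, ← pow_mul, mul_comm (m + 10) 3]
    norm_cast
  rw [hz₁, hz₂, ← pow_mul, div_eq_mul_inv, mul_inv, mul_assoc (8 * alpha ^ 8)]
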